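/- arXiv:2105.15127 — 7 statements merged into one kernel-verified Lean document; each statement's English description precedes it below -/
import Mathlib

section
/- For every integer A ≥ 3, the balancing-like sequence is a strong divisibility sequence: for all positive integers m and n, gcd(x_m, x_n) = x_{gcd(m,n)}. -/
/-- The balancing-like sequence: `x 0 = 0`, `x 1 = 1`, `x (n+2) = A * x (n+1) - x n`. -/
def balLike (A : ℤ) : ℕ → ℤ
  | 0 => 0
  | 1 => 1
  | n + 2 => A * balLike A (n + 1) - balLike A n

theorem balLike_add_two (A : ℤ) (n : ℕ) :
    balLike A (n + 2) = A * balLike A (n + 1) - balLike A n := rfl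

theorem balLike_add (A : ℤ) (m n : ℕ) :
    balLike A (m + n + 1) =
      balLike A (m + 1) * balLike A (n + 1) - balLike A m * balLike A n := by
  induction m generalizing n with
  | zero => simp [balLike]
  | succ m ih =>
    rw [show m + 1 + n + 1 = m + (n + 1) + 1 by ring, ih, balLike_add_two, balLike_add_two]
    ring

theorem balLike_isCoprime_succ (A : ℤ) (n : ℕ) :
    IsCoprime (balLike A (n + 1)) (balLike A n) := by
  induction n with
  | zero => exact isCoprime_one_left
  | succ n ih =>
    rw [balLike_add_two, sub_eq_neg_add, add_comm, mul_comm]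
    exact IsCoprime.mul_add_left_left ih.symm.neg_left A

theorem balLike_gcd_add_self (A : ℤ) (m n : ℕ) :
    Int.gcd (balLike A m) (balLike A (n + m)) = Int.gcd (balLike A m) (balLike A n) := by
  cases m with
  | zero => rfl
  | succ m =>
    rw [show n + (m + 1) = m + n + 1 by ring, balLike_add, Int.gcd_mul_left_sub_right]
    exact Int.gcd_mul_right_right_of_gcd_eq_one
      (Int.isCoprime_iff_gcd_eq_one.mp (balLike_isCoprime_succ A m))

theorem balLike_nonneg_and_lt_succ {A : ℤ} (hA : 2 ≤ A) (n : ℕ) :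
    0 ≤ balLike A n ∧ balLike A n < balLike A (n + 1) := by
  induction n with
  | zero => simp [balLike]
  | succ n ih =>
    rw [balLike_add_two]
    constructor <;> nlinarith

theorem balLike_gcd {A : ℤ} (hA : 2 ≤ A) (m n : ℕ) :
    (Int.gcd (balLike A m) (balLike A n) : ℤ) = balLike A (Nat.gcd m n) := by
  have gcd_add_mul (m n k : ℕ) :
      Int.gcd (balLike A m) (balLike A (n + m * k)) =
        Int.gcd (balLike A m) (balLike A n) := by
    induction k with
    | zero => rfl
    | succ k ih => rw [Nat.mul_succ, ← add_assoc, balLike_gcd_add_self, ih]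
  induction m, n using Nat.gcd.induction with
  | H0 n => simp [balLike, abs_of_nonneg (balLike_nonneg_and_lt_succ hA n).1]
  | H1 m n _ ih =>
    rw [Nat.gcd_rec, ← ih, Int.gcd_comm (balLike A (n % m)), ← gcd_add_mul m (n % m) (n / m),
      Nat.mod_add_div]

theorem balLike_strong_divisibility (A : ℤ) (hA : 3 ≤ A) (m n : ℕ)
    (hm : 0 < m) (hn : 0 < n) :
    (Int.gcd (balLike A m) (balLike A n) : ℤ) = balLike A (Nat.gcd m n) :=
  balLike_gcd (by lia) m n
end

section
/- Let A ≥ 3 be an integer and let C₁, C₂ be nonzero integers. If C₁ x_{n₁} + C₂ x_{n₂} = 0 with n₁ > n₂ ≥ 1, then the integer x_{n₁}/x_d divides C₂, where d = gcd(n₁, n₂). -/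
theorem isCoprime_balLike_succ (A : ℤ) (n : ℕ) :
    IsCoprime (balLike A n) (balLike A (n + 1)) := by
  induction n with
  | zero => exact isCoprime_one_right
  | succ n ih =>
    obtain ⟨u, v, h⟩ := ih
    refine ⟨v + u * A, -u, ?_⟩
    rw [balLike_add_two]
    linear_combination h

theorem balLike_pos {A : ℤ} (hA : 2 ≤ A) {n : ℕ} (hn : 0 < n) : 0 < balLike A n := by
  obtain ⟨k, rfl⟩ := Nat.exists_eq_succ_of_ne_zero hn.ne'
  have h := balLike_nonneg_and_lt_succ hA k
  exact h.1.trans_lt h.2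

theorem dvd_balLike_add_iff {A c : ℤ} {m : ℕ} (hc : c ∣ balLike A m) (n : ℕ) :
    c ∣ balLike A (n + m) ↔ c ∣ balLike A n := by
  cases n with
  | zero => simpa [balLike] using hc
  | succ k =>
    have hco : IsCoprime c (balLike A (m + 1)) :=
      (isCoprime_balLike_succ A m).of_isCoprime_of_dvd_left hc
    rw [show k + 1 + m = m + k + 1 by omega, balLike_add,
      dvd_sub_left (hc.mul_right (balLike A k))]
    exact ⟨hco.dvd_of_dvd_mul_left, fun h => h.mul_left _⟩

theorem dvd_balLike_add_mul_iff {A c : ℤ} {m : ℕ} (hc : c ∣ balLike A m) (n k : ℕ) :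
    c ∣ balLike A (n + m * k) ↔ c ∣ balLike A n := by
  induction k with
  | zero => simp
  | succ k ih => rw [Nat.mul_succ, ← Nat.add_assoc, dvd_balLike_add_iff hc, ih]

theorem dvd_balLike_gcd_iff (A c : ℤ) (m n : ℕ) :
    c ∣ balLike A (Nat.gcd m n) ↔ c ∣ balLike A m ∧ c ∣ balLike A n := by
  induction m, n using Nat.gcd.induction with
  | H0 n => simp [balLike]
  | H1 m n _ ih =>
    rw [Nat.gcd_rec, ih, and_comm]
    refine and_congr_right fun hc => ?_
    rw [← dvd_balLike_add_mul_iff hc (n % m) (n / m), Nat.mod_add_div]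

theorem isCoprime_of_balLike_eq_gcd_mul {A : ℤ} (hA : 2 ≤ A) {m n : ℕ} (hn : 0 < n) {a b : ℤ}
    (ha : balLike A m = balLike A (Nat.gcd m n) * a)
    (hb : balLike A n = balLike A (Nat.gcd m n) * b) : IsCoprime a b := by
  have hd := balLike_pos hA (Nat.gcd_pos_of_pos_right m hn)
  have h : balLike A (Nat.gcd m n) * (Int.gcd a b : ℤ) ∣ balLike A (Nat.gcd m n) * 1 := by
    rw [mul_one, dvd_balLike_gcd_iff, ha, hb]
    exact ⟨mul_dvd_mul_left _ (Int.gcd_dvd_left ..), mul_dvd_mul_left _ (Int.gcd_dvd_right ..)⟩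
  rw [Int.isCoprime_iff_gcd_eq_one]
  exact Nat.dvd_one.mp (by exact_mod_cast Int.dvd_of_mul_dvd_mul_left hd.ne' h)

theorem ratio_divides (A : ℤ) (hA : 3 ≤ A) (C₁ C₂ : ℤ) (hC₁ : C₁ ≠ 0) (hC₂ : C₂ ≠ 0)
    (n₁ n₂ : ℕ) (h12 : n₁ > n₂) (hn₂ : 1 ≤ n₂)
    (heq : C₁ * balLike A n₁ + C₂ * balLike A n₂ = 0) :
    balLike A n₁ / balLike A (Nat.gcd n₁ n₂) ∣ C₂ := by
  have hA' : 2 ≤ A := by linarith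
  have hd := balLike_pos hA' (Nat.gcd_pos_of_pos_right n₁ hn₂)
  obtain ⟨⟨a, ha⟩, b, hb⟩ := (dvd_balLike_gcd_iff A _ n₁ n₂).mp dvd_rfl
  have hab := isCoprime_of_balLike_eq_gcd_mul hA' hn₂ ha hb
  rw [Int.ediv_eq_of_eq_mul_right hd.ne' ha]
  refine hab.dvd_of_dvd_mul_right ⟨-C₁, mul_left_cancel₀ hd.ne' ?_⟩
  rw [ha, hb] at heq
  linear_combination heq
end

section
/- Let A ≥ 3 be an integer and let A₁, A₂, A₃, A₄ be integers with A₁ ≠ 0 and |A_i| ≤ X for all i, where X ≥ 1. If A₁ x_{m₁} + A₂ x_{m₂} + A₃ x_{m₃} + A₄ x_{m₄} = 0 with m₁ > m₂ ≥ m₃ ≥ m₄ ≥ 0, then γ^{m₁ − m₂} < 7X, where γ = (A + √(A²−4))/2. -/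
theorem balLike_succ_eq {A : ℤ} {γ : ℝ} (hγ : γ * (A - γ) = 1) (n : ℕ) :
    (balLike A (n + 1) : ℝ) = γ * balLike A n + (A - γ) ^ n := by
  induction n with
  | zero => simp [balLike]
  | succ n ih =>
    have h : (balLike A (n + 2) : ℝ) = A * balLike A (n + 1) - balLike A n := by
      simp [balLike]
    rw [h, pow_succ]
    linear_combination ((A : ℝ) - γ) * ih + (balLike A n : ℝ) * hγ

theorem pow_mul_balLike_le {A : ℤ} {γ : ℝ} (hγ : γ * (A - γ) = 1) (hpos : 0 < γ)
    (n k : ℕ) : γ ^ k * balLike A n ≤ (balLike A (n + k) : ℝ) := by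
  have hδ : 0 < (A : ℝ) - γ := pos_of_mul_pos_right (hγ ▸ one_pos) hpos.le
  induction k with
  | zero => simp
  | succ k ih =>
    rw [← add_assoc, balLike_succ_eq hγ, pow_succ']
    nlinarith [mul_le_mul_of_nonneg_left ih hpos.le, pow_pos hδ (n + k)]

theorem balLike_nonneg {A : ℤ} {γ : ℝ} (hγ : γ * (A - γ) = 1) (hpos : 0 < γ) (n : ℕ) :
    (0 : ℝ) ≤ balLike A n := by
  simpa [balLike] using pow_mul_balLike_le hγ hpos 0 n

theorem balLike_mono {A : ℤ} {γ : ℝ} (hγ : γ * (A - γ) = 1) (hone : 1 ≤ γ) {m n : ℕ}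
    (hmn : m ≤ n) : (balLike A m : ℝ) ≤ balLike A n := by
  obtain ⟨k, rfl⟩ := Nat.exists_eq_add_of_le hmn
  have hpos : 0 < γ := one_pos.trans_le hone
  exact (le_mul_of_one_le_left (balLike_nonneg hγ hpos m) (one_le_pow₀ hone)).trans
    (pow_mul_balLike_le hγ hpos m k)

theorem balLike_succ_pos {A : ℤ} {γ : ℝ} (hγ : γ * (A - γ) = 1) (hone : 1 ≤ γ) (n : ℕ) :
    (0 : ℝ) < balLike A (n + 1) := by
  have h := balLike_mono hγ hone (Nat.le_add_left 1 n)
  simp only [balLike, Int.cast_one] at h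
  linarith

theorem four_term_gap_bound (A : ℤ) (hA : 3 ≤ A) (A₁ A₂ A₃ A₄ X : ℤ)
    (hA₁ : A₁ ≠ 0) (hX : 1 ≤ X)
    (h1 : |A₁| ≤ X) (h2 : |A₂| ≤ X) (h3 : |A₃| ≤ X) (h4 : |A₄| ≤ X)
    (m₁ m₂ m₃ m₄ : ℕ) (h12 : m₁ > m₂) (h23 : m₂ ≥ m₃) (h34 : m₃ ≥ m₄)
    (heq : A₁ * balLike A m₁ + A₂ * balLike A m₂ + A₃ * balLike A m₃ +
      A₄ * balLike A m₄ = 0)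
    (γ : ℝ) (hγ : γ = ((A : ℝ) + Real.sqrt ((A : ℝ) ^ 2 - 4)) / 2) :
    γ ^ (m₁ - m₂) < 7 * (X : ℝ) := by
  have hA' : (3 : ℝ) ≤ A := by exact_mod_cast hA
  have hsq : Real.sqrt ((A : ℝ) ^ 2 - 4) ^ 2 = (A : ℝ) ^ 2 - 4 :=
    Real.sq_sqrt (by nlinarith)
  have hroot : γ * (A - γ) = 1 := by
    rw [hγ]
    linear_combination (-1 / 4 : ℝ) * hsq
  have hone : 1 ≤ γ := by
    rw [hγ]
    linarith [Real.sqrt_nonneg ((A : ℝ) ^ 2 - 4)]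
  have hpos : 0 < γ := one_pos.trans_le hone
  have hX' : (1 : ℝ) ≤ X := by exact_mod_cast hX
  have hterm : ∀ (a : ℤ) (m : ℕ), |a| ≤ X → m ≤ m₂ →
      -((X : ℝ) * balLike A m₂) ≤ a * balLike A m ∧
        (a : ℝ) * balLike A m ≤ X * balLike A m₂ := by
    intro a m ha hm
    have ha' : |(a : ℝ)| ≤ X := by exact_mod_cast ha
    rw [← abs_le, abs_mul, abs_of_nonneg (balLike_nonneg hroot hpos m)]
    exact mul_le_mul ha' (balLike_mono hroot hone hm) (balLike_nonneg hroot hpos m)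
      (by linarith)
  obtain ⟨l2, u2⟩ := hterm A₂ m₂ h2 le_rfl
  obtain ⟨l3, u3⟩ := hterm A₃ m₃ h3 h23
  obtain ⟨l4, u4⟩ := hterm A₄ m₄ h4 (h34.trans h23)
  have heq' : (A₁ : ℝ) * balLike A m₁ + A₂ * balLike A m₂ + A₃ * balLike A m₃ +
      A₄ * balLike A m₄ = 0 := by exact_mod_cast heq
  have hlead : (balLike A m₁ : ℝ) ≤ 3 * (X * balLike A m₂) := by
    have hA₁' : (1 : ℝ) ≤ |(A₁ : ℝ)| := by exact_mod_cast Int.one_le_abs hA₁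
    have hnonneg := balLike_nonneg hroot hpos m₁
    calc (balLike A m₁ : ℝ) ≤ |(A₁ : ℝ)| * balLike A m₁ := le_mul_of_one_le_left hnonneg hA₁'
      _ = |(A₁ : ℝ) * balLike A m₁| := by rw [abs_mul, abs_of_nonneg hnonneg]
      _ ≤ 3 * (X * balLike A m₂) := abs_le.mpr ⟨by linarith, by linarith⟩
  have hx₁ : (0 : ℝ) < balLike A m₁ := by
    obtain ⟨k, rfl⟩ := Nat.exists_eq_succ_of_ne_zero (Nat.ne_of_gt (Nat.zero_lt_of_lt h12))
    exact balLike_succ_pos hroot hone k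
  have hx₂ : (0 : ℝ) < balLike A m₂ :=
    pos_of_mul_pos_right (by linarith : (0 : ℝ) < X * balLike A m₂) (by linarith)
  have hgap := pow_mul_balLike_le hroot hpos m₂ (m₁ - m₂)
  rw [Nat.add_sub_cancel' h12.le] at hgap
  have hle : γ ^ (m₁ - m₂) ≤ 3 * X :=
    le_of_mul_le_mul_right (by linarith) hx₂
  linarith
end

section
/- Let A ≥ 3 be an integer, γ = (A + √(A²−4))/2, δ = (A − √(A²−4))/2. For all integers A₁, …, A₆ and all natural numbers k₁, …, k₆, the product (A₁γ^{k₁} + ⋯ + A₆γ^{k₆})·(A₁δ^{k₁} + ⋯ + A₆δ^{k₆}) is an integer; consequently, if A₁γ^{k₁} + ⋯ + A₆γ^{k₆} ≠ 0 and X = max(|A₁|, …, |A₆|) ≥ 1, then |A₁γ^{k₁} + ⋯ + A₆γ^{k₆}| ≥ 1/(6X). -/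
theorem cast_norm_form {A : ℤ} {γ δ : ℝ} (hadd : γ + δ = A) (hmul : γ * δ = 1) (a b : ℤ) :
    ((a ^ 2 + A * a * b + b ^ 2 : ℤ) : ℝ) = (a + b * γ) * (a + b * δ) := by
  push_cast
  linear_combination -(a * b : ℝ) * hadd - (b : ℝ) ^ 2 * hmul

/-- `x` and `y` are the images of one element `a + b X` of `ℤ[X]` at `γ` and at `δ`. -/
def IsConjPair (γ δ x y : ℝ) : Prop :=
  ∃ a b : ℤ, x = a + b * γ ∧ y = a + b * δ

namespace IsConjPair

variable {γ δ x y x' y' : ℝ}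

theorem add (h : IsConjPair γ δ x y) (h' : IsConjPair γ δ x' y') :
    IsConjPair γ δ (x + x') (y + y') := by
  obtain ⟨a, b, rfl, rfl⟩ := h
  obtain ⟨c, d, rfl, rfl⟩ := h'
  exact ⟨a + c, b + d, by push_cast; ring, by push_cast; ring⟩

theorem int_mul (m : ℤ) (h : IsConjPair γ δ x y) : IsConjPair γ δ (m * x) (m * y) := by
  obtain ⟨a, b, rfl, rfl⟩ := h
  exact ⟨m * a, m * b, by push_cast; ring, by push_cast; ring⟩

theorem pow {A : ℤ} (hadd : γ + δ = A) (hmul : γ * δ = 1) (k : ℕ) :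
    IsConjPair γ δ (γ ^ k) (δ ^ k) := by
  induction k with
  | zero => exact ⟨1, 0, by simp, by simp⟩
  | succ k ih =>
    obtain ⟨a, b, hx, hy⟩ := ih
    refine ⟨-b, a + b * A, ?_, ?_⟩
    · rw [pow_succ, hx]
      push_cast
      linear_combination b * γ * hadd - b * hmul
    · rw [pow_succ, hy]
      push_cast
      linear_combination b * δ * hadd - b * hmul

theorem exists_int_eq_mul {A : ℤ} (hadd : γ + δ = A) (hmul : γ * δ = 1)
    (h : IsConjPair γ δ x y) : ∃ z : ℤ, (z : ℝ) = x * y := by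
  obtain ⟨a, b, rfl, rfl⟩ := h
  exact ⟨_, cast_norm_form hadd hmul a b⟩

end IsConjPair

theorem sq_ne_sq_sub_four {A : ℤ} (hA : 3 ≤ A) (c : ℤ) : c ^ 2 ≠ A ^ 2 - 4 := by
  intro h
  have h₁ : |c| < A := abs_lt_of_sq_lt_sq (by linarith) (by linarith)
  have h₂ : A - 1 < |c| := lt_abs.2 <| by
    by_contra! hc
    nlinarith [hc.1, hc.2]
  omega

/-- The norm form `a² + A a b + b²` is anisotropic over `ℤ` when `A ≥ 3`. -/
theorem eq_zero_of_norm_form_eq_zero {A : ℤ} (hA : 3 ≤ A) {a b : ℤ}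
    (h : a ^ 2 + A * a * b + b ^ 2 = 0) : a = 0 ∧ b = 0 := by
  have hb : b = 0 := by
    by_contra hb
    have hsq : (2 * a + A * b) ^ 2 = b ^ 2 * (A ^ 2 - 4) := by linear_combination 4 * h
    obtain ⟨c, hc⟩ := (Int.pow_dvd_pow_iff two_ne_zero).1 (Dvd.intro _ hsq.symm)
    rw [hc, mul_pow] at hsq
    exact sq_ne_sq_sub_four hA c (mul_left_cancel₀ (pow_ne_zero 2 hb) hsq)
  subst hb
  exact ⟨by simpa using h, rfl⟩

theorem IsConjPair.one_le_abs_mul {γ δ x y : ℝ} {A : ℤ} (hA : 3 ≤ A) (hadd : γ + δ = A)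
    (hmul : γ * δ = 1) (h : IsConjPair γ δ x y) (hx : x ≠ 0) : 1 ≤ |x| * |y| := by
  obtain ⟨a, b, rfl, rfl⟩ := h
  rw [← abs_mul, ← cast_norm_form hadd hmul, ← Int.cast_abs]
  refine mod_cast Int.one_le_abs fun h0 => hx ?_
  obtain ⟨rfl, rfl⟩ := eq_zero_of_norm_form_eq_zero hA h0
  simp


theorem norm_lower_bound_six (A : ℤ) (hA : 3 ≤ A) (γ δ : ℝ)
    (hγ : γ = ((A : ℝ) + Real.sqrt ((A : ℝ) ^ 2 - 4)) / 2)
    (hδ : δ = ((A : ℝ) - Real.sqrt ((A : ℝ) ^ 2 - 4)) / 2)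
    (A₁ A₂ A₃ A₄ A₅ A₆ : ℤ) (k₁ k₂ k₃ k₄ k₅ k₆ : ℕ) :
    (∃ z : ℤ, (z : ℝ) =
      ((A₁ : ℝ) * γ ^ k₁ + (A₂ : ℝ) * γ ^ k₂ + (A₃ : ℝ) * γ ^ k₃ +
        (A₄ : ℝ) * γ ^ k₄ + (A₅ : ℝ) * γ ^ k₅ + (A₆ : ℝ) * γ ^ k₆) *
      ((A₁ : ℝ) * δ ^ k₁ + (A₂ : ℝ) * δ ^ k₂ + (A₃ : ℝ) * δ ^ k₃ +
        (A₄ : ℝ) * δ ^ k₄ + (A₅ : ℝ) * δ ^ k₅ + (A₆ : ℝ) * δ ^ k₆)) ∧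
    (∀ X : ℤ, X = max |A₁| (max |A₂| (max |A₃| (max |A₄| (max |A₅| |A₆|)))) → 1 ≤ X →
      (A₁ : ℝ) * γ ^ k₁ + (A₂ : ℝ) * γ ^ k₂ + (A₃ : ℝ) * γ ^ k₃ +
        (A₄ : ℝ) * γ ^ k₄ + (A₅ : ℝ) * γ ^ k₅ + (A₆ : ℝ) * γ ^ k₆ ≠ 0 →
      |(A₁ : ℝ) * γ ^ k₁ + (A₂ : ℝ) * γ ^ k₂ + (A₃ : ℝ) * γ ^ k₃ +
        (A₄ : ℝ) * γ ^ k₄ + (A₅ : ℝ) * γ ^ k₅ + (A₆ : ℝ) * γ ^ k₆| ≥ 1 / (6 * (X : ℝ))) := by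
  have hA' : (3 : ℝ) ≤ A := mod_cast hA
  have hs : Real.sqrt ((A : ℝ) ^ 2 - 4) ^ 2 = (A : ℝ) ^ 2 - 4 := Real.sq_sqrt (by nlinarith)
  have hs0 := Real.sqrt_nonneg ((A : ℝ) ^ 2 - 4)
  have hadd : γ + δ = A := by rw [hγ, hδ]; ring
  have hmul : γ * δ = 1 := by rw [hγ, hδ]; linear_combination -hs / 4
  have hδ0 : 0 ≤ δ := by rw [hδ]; nlinarith
  have hδ1 : δ ≤ 1 := by rw [hδ]; nlinarith
  have hpair (m : ℤ) (k : ℕ) : IsConjPair γ δ (m * γ ^ k) (m * δ ^ k) :=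
    (IsConjPair.pow hadd hmul k).int_mul m
  have hsum := (((((hpair A₁ k₁).add (hpair A₂ k₂)).add (hpair A₃ k₃)).add
    (hpair A₄ k₄)).add (hpair A₅ k₅)).add (hpair A₆ k₆)
  refine ⟨hsum.exists_int_eq_mul hadd hmul, fun X hX hX1 hne => ?_⟩
  have hnorm := hsum.one_le_abs_mul hA hadd hmul hne
  have hX0 : (0 : ℝ) < X := mod_cast hX1
  have hterm (m : ℤ) (k : ℕ) (hm : |m| ≤ X) : |(m : ℝ) * δ ^ k| ≤ X := by
    rw [abs_mul, abs_of_nonneg (pow_nonneg hδ0 k)]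
    have hm' : |(m : ℝ)| ≤ X := mod_cast hm
    exact (mul_le_of_le_one_right (abs_nonneg _) (pow_le_one₀ hδ0 hδ1)).trans hm'
  have h₁ := abs_le.1 (hterm A₁ k₁ (by simp [hX]))
  have h₂ := abs_le.1 (hterm A₂ k₂ (by simp [hX]))
  have h₃ := abs_le.1 (hterm A₃ k₃ (by simp [hX]))
  have h₄ := abs_le.1 (hterm A₄ k₄ (by simp [hX]))
  have h₅ := abs_le.1 (hterm A₅ k₅ (by simp [hX]))
  have h₆ := abs_le.1 (hterm A₆ k₆ (by simp [hX]))
  rw [ge_iff_le, div_le_iff₀ (by positivity)]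
  refine hnorm.trans (mul_le_mul_of_nonneg_left (abs_le.2 ⟨?_, ?_⟩) (abs_nonneg _)) <;> linarith
end

section
/- Let A ≥ 3 be an integer, γ = (A + √(A²−4))/2. Let A₁, A₂, A₃ be integers and j > i > 0 natural numbers such that A₁γ^j + A₂γ^i + A₃ = 0. Then for every natural number m, A₁ x_{m+j} + A₂ x_{m+i} + A₃ x_m = 0; i.e., the tuples (m₁, m₂, m₃) = (m + j, m + i, m) form a parametric family of solutions of A₁ x_{m₁} + A₂ x_{m₂} + A₃ x_{m₃} = 0. -/
theorem pow_succ_eq_balLike {A : ℤ} {γ : ℝ} (hγ : γ ^ 2 = A * γ - 1) (n : ℕ) :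
    γ ^ (n + 1) = balLike A (n + 1) * γ - balLike A n := by
  induction n with
  | zero => simp [balLike]
  | succ n ih =>
    rw [pow_succ, ih, balLike]
    push_cast
    linear_combination (balLike A (n + 1) : ℝ) * hγ

/-- For `A ≥ 3` the discriminant `A ^ 2 - 4` is not a square, so the roots of
`X ^ 2 - A * X + 1` are irrational. -/
theorem eq_zero_of_sq_eq_mul_sub_sq {A p q : ℤ} (hA : 3 ≤ A) (h : q ^ 2 = A * q * p - p ^ 2) :
    p = 0 := by
  by_contra hp
  have hsq : (2 * q - A * p) ^ 2 = (A ^ 2 - 4) * p ^ 2 := by linear_combination 4 * h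
  obtain ⟨k, hk⟩ : p ∣ 2 * q - A * p :=
    (Int.pow_dvd_pow_iff two_ne_zero).1 (hsq ▸ Dvd.intro_left _ rfl)
  have hk2 : k ^ 2 = A ^ 2 - 4 := by
    apply mul_right_cancel₀ (pow_ne_zero 2 hp)
    rw [← hsq, hk]
    ring
  have hlt : |k| < A := abs_lt_of_sq_lt_sq (by linarith) (by linarith)
  have hgt : A - 1 < |k| := by
    apply lt_of_pow_lt_pow_left₀ 2 (abs_nonneg k)
    rw [sq_abs]
    linarith
  linarith [Int.add_one_le_iff.2 hgt]

theorem parametric_family_three (A : ℤ) (hA : 3 ≤ A) (γ : ℝ)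
    (hγ : γ = ((A : ℝ) + Real.sqrt ((A : ℝ) ^ 2 - 4)) / 2)
    (A₁ A₂ A₃ : ℤ) (i j : ℕ) (hij : j > i) (hi : i > 0)
    (hroot : (A₁ : ℝ) * γ ^ j + (A₂ : ℝ) * γ ^ i + (A₃ : ℝ) = 0) :
    ∀ m : ℕ, A₁ * balLike A (m + j) + A₂ * balLike A (m + i) + A₃ * balLike A m = 0 := by
  intro m
  have hA' : (3 : ℝ) ≤ A := by exact_mod_cast hA
  have hγ2 : γ ^ 2 = A * γ - 1 := by
    have hs := Real.sq_sqrt (show (0 : ℝ) ≤ (A : ℝ) ^ 2 - 4 by nlinarith)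
    rw [hγ]
    linear_combination hs / 4
  set y : ℕ → ℤ := fun n =>
    A₁ * balLike A (n + j) + A₂ * balLike A (n + i) + A₃ * balLike A n with hy
  have hlin : (y (m + 1) : ℝ) * γ - y m = 0 := by
    have hj := pow_succ_eq_balLike hγ2 (m + j)
    have hi' := pow_succ_eq_balLike hγ2 (m + i)
    have hm := pow_succ_eq_balLike hγ2 m
    simp only [hy, Nat.add_right_comm m 1]
    push_cast
    linear_combination γ ^ (m + 1) * hroot - A₁ * hj - A₂ * hi' - A₃ * hm
  have hquad : y m ^ 2 = A * y m * y (m + 1) - y (m + 1) ^ 2 := by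
    have h : (y m : ℝ) ^ 2 = A * y m * y (m + 1) - (y (m + 1) : ℝ) ^ 2 := by
      rw [← sub_eq_zero.1 hlin]
      linear_combination (y (m + 1) : ℝ) ^ 2 * hγ2
    exact_mod_cast h
  have hzero : y (m + 1) = 0 := eq_zero_of_sq_eq_mul_sub_sq hA hquad
  simpa [hzero] using hlin
end

section
/- Let A ≥ 3 be an integer, γ = (A + √(A²−4))/2, and let A₁, …, A₆ be integers with |A_i| ≤ X for all i, X ≥ 1. Suppose A₁ x_{m₁} + A₂ x_{m₂} + A₃ x_{m₃} + A₄ x_{m₄} + A₅ x_{m₅} + A₆ x_{m₆} = 0 with m₁ ≥ m₂ ≥ m₃ ≥ m₄ ≥ m₅ ≥ m₆ ≥ 0, and that A₁γ^{m₁−m₆} + A₂γ^{m₂−m₆} + A₃γ^{m₃−m₆} + A₄γ^{m₄−m₆} + A₅γ^{m₅−m₆} + A₆ ≠ 0. Then γ^{m₆} ≤ 6X, and hence m₆ ≤ log(6X)/log ψ where ψ = (3 + √5)/2. -/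
theorem sub_mul_balLike {A : ℤ} {γ δ : ℝ} (hadd : γ + δ = A) (hmul : γ * δ = 1) (n : ℕ) :
    (γ - δ) * balLike A n = γ ^ n - δ ^ n := by
  induction n using Nat.twoStepInduction with
  | zero => simp [balLike]
  | one => simp [balLike]
  | more n ih₀ ih₁ =>
    simp only [balLike, Int.cast_sub, Int.cast_mul, ← hadd]
    linear_combination (γ + δ) * ih₁ - ih₀ + (γ ^ n - δ ^ n) * hmul

theorem exists_conj_pow {A : ℤ} {γ δ : ℝ} (hadd : γ + δ = A) (hmul : γ * δ = 1) (n : ℕ) :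
    ∃ a b : ℤ, γ ^ n = a * γ + b ∧ δ ^ n = a * δ + b := by
  induction n with
  | zero => exact ⟨0, 1, by simp⟩
  | succ n ih =>
    obtain ⟨a, b, hγ, hδ⟩ := ih
    refine ⟨a * A + b, -a, ?_, ?_⟩ <;> push_cast <;> rw [← hadd]
    · linear_combination γ * hγ - a * hmul
    · linear_combination δ * hδ - a * hmul

theorem exists_int_eq_sum_mul_sum {ι : Type*} [Fintype ι] {A : ℤ} {γ δ : ℝ}
    (hadd : γ + δ = A) (hmul : γ * δ = 1) (c : ι → ℤ) (k : ι → ℕ) :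
    ∃ N : ℤ, (∑ i, (c i : ℝ) * γ ^ k i) * (∑ i, (c i : ℝ) * δ ^ k i) = N := by
  choose a b hγ hδ using fun i => exists_conj_pow hadd hmul (k i)
  set a' := ∑ i, c i * a i with ha
  set b' := ∑ i, c i * b i with hb
  have hP : ∑ i, (c i : ℝ) * γ ^ k i = a' * γ + b' := by
    rw [ha, hb]
    push_cast
    rw [Finset.sum_mul, ← Finset.sum_add_distrib]
    exact Finset.sum_congr rfl fun i _ => by rw [hγ]; ring
  have hQ : ∑ i, (c i : ℝ) * δ ^ k i = a' * δ + b' := by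
    rw [ha, hb]
    push_cast
    rw [Finset.sum_mul, ← Finset.sum_add_distrib]
    exact Finset.sum_congr rfl fun i _ => by rw [hδ]; ring
  refine ⟨a' ^ 2 + a' * b' * A + b' ^ 2, ?_⟩
  rw [hP, hQ]
  push_cast
  rw [← hadd]
  linear_combination (a' : ℝ) ^ 2 * hmul

/-- If an integer combination of the terms `balLike A (n + k i)` vanishes while the corresponding
combination of the powers `γ ^ k i` of the dominant root does not, then `γ ^ n` is bounded by the
number of terms times the largest coefficient. -/
theorem pow_le_card_mul_of_sum_balLike_eq_zero {ι : Type*} [Fintype ι] {A : ℤ} {γ δ : ℝ}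
    (hadd : γ + δ = A) (hmul : γ * δ = 1) (hγ : 1 < γ) {c : ι → ℤ} {k : ι → ℕ} {n : ℕ} {X : ℤ}
    (hc : ∀ i, |c i| ≤ X) (hsum : ∑ i, c i * balLike A (n + k i) = 0)
    (hne : ∑ i, (c i : ℝ) * γ ^ k i ≠ 0) :
    γ ^ n ≤ Fintype.card ι * (X : ℝ) := by
  have hδ₀ : 0 < δ := by
    by_contra! h
    nlinarith
  have hδ₁ : δ ≤ 1 := by nlinarith
  obtain ⟨N, hN⟩ := exists_int_eq_sum_mul_sum hadd hmul c k
  set P := ∑ i, (c i : ℝ) * γ ^ k i with hP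
  set Q := ∑ i, (c i : ℝ) * δ ^ k i with hQ
  have hPQ : γ ^ n * P = δ ^ n * Q := by
    have hsum' : ∑ i, (c i : ℝ) * balLike A (n + k i) = 0 := by exact_mod_cast hsum
    rw [← sub_eq_zero, hP, hQ, Finset.mul_sum, Finset.mul_sum, ← Finset.sum_sub_distrib]
    calc _ = ∑ i, (γ - δ) * ((c i : ℝ) * balLike A (n + k i)) :=
          Finset.sum_congr rfl fun i _ => by
            linear_combination -(c i : ℝ) * sub_mul_balLike hadd hmul (n + k i)
      _ = 0 := by rw [← Finset.mul_sum, hsum', mul_zero]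
  have hpow : γ ^ n * δ ^ n = 1 := by rw [← mul_pow, hmul, one_pow]
  have hQeq : Q = (γ ^ n) ^ 2 * P := by linear_combination -γ ^ n * hPQ - Q * hpow
  have hγn : 0 < γ ^ n := by positivity
  have hNpos : 0 < (N : ℝ) := by
    have : 0 < P ^ 2 := by positivity
    rw [← hN, hQeq]
    calc (0 : ℝ) < (γ ^ n) ^ 2 * P ^ 2 := by positivity
      _ = _ := by ring
  have hNone : (1 : ℝ) ≤ N := by
    have : 0 < N := by exact_mod_cast hNpos
    exact_mod_cast this
  have hQle : |Q| ≤ Fintype.card ι * (X : ℝ) := by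
    calc |Q| ≤ ∑ i, |(c i : ℝ) * δ ^ k i| := Finset.abs_sum_le_sum_abs _ _
      _ ≤ ∑ _i : ι, (X : ℝ) := Finset.sum_le_sum fun i _ => by
        have hci : |(c i : ℝ)| ≤ X := by exact_mod_cast hc i
        rw [abs_mul, abs_of_pos (pow_pos hδ₀ _)]
        exact (mul_le_of_le_one_right (abs_nonneg _) (pow_le_one₀ hδ₀.le hδ₁)).trans hci
      _ = _ := by simp
  refine le_trans ?_ hQle
  refine (sq_le_sq₀ hγn.le (abs_nonneg _)).mp ?_
  rw [sq_abs]
  calc (γ ^ n) ^ 2 ≤ (γ ^ n) ^ 2 * N := le_mul_of_one_le_right (by positivity) hNone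
    _ = Q ^ 2 := by rw [← hN]; linear_combination -Q * hQeq

theorem bound_m6 (A : ℤ) (hA : 3 ≤ A) (γ ψ : ℝ)
    (hγ : γ = ((A : ℝ) + Real.sqrt ((A : ℝ) ^ 2 - 4)) / 2)
    (hψ : ψ = (3 + Real.sqrt 5) / 2)
    (A₁ A₂ A₃ A₄ A₅ A₆ X : ℤ) (hX : 1 ≤ X)
    (h1 : |A₁| ≤ X) (h2 : |A₂| ≤ X) (h3 : |A₃| ≤ X) (h4 : |A₄| ≤ X)
    (h5 : |A₅| ≤ X) (h6 : |A₆| ≤ X)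
    (m₁ m₂ m₃ m₄ m₅ m₆ : ℕ) (h12 : m₁ ≥ m₂) (h23 : m₂ ≥ m₃) (h34 : m₃ ≥ m₄)
    (h45 : m₄ ≥ m₅) (h56 : m₅ ≥ m₆)
    (heq : A₁ * balLike A m₁ + A₂ * balLike A m₂ + A₃ * balLike A m₃ +
      A₄ * balLike A m₄ + A₅ * balLike A m₅ + A₆ * balLike A m₆ = 0)
    (hne : (A₁ : ℝ) * γ ^ (m₁ - m₆) + (A₂ : ℝ) * γ ^ (m₂ - m₆) + (A₃ : ℝ) * γ ^ (m₃ - m₆) +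
      (A₄ : ℝ) * γ ^ (m₄ - m₆) + (A₅ : ℝ) * γ ^ (m₅ - m₆) + (A₆ : ℝ) ≠ 0) :
    γ ^ m₆ ≤ 6 * (X : ℝ) ∧ (m₆ : ℝ) ≤ Real.log (6 * (X : ℝ)) / Real.log ψ := by
  have hA' : (3 : ℝ) ≤ A := by exact_mod_cast hA
  have hψγ : ψ ≤ γ := by
    have : Real.sqrt 5 ≤ Real.sqrt ((A : ℝ) ^ 2 - 4) := Real.sqrt_le_sqrt (by nlinarith)
    rw [hψ, hγ]
    linarith
  have hψ1 : 1 < ψ := by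
    rw [hψ]
    linarith [Real.sqrt_nonneg 5]
  have hX' : (1 : ℝ) ≤ X := by exact_mod_cast hX
  have hbound : γ ^ m₆ ≤ 6 * (X : ℝ) := by
    have hmul : γ * (A - γ) = 1 := by
      rw [hγ]
      linear_combination -(1 / 4 : ℝ) * Real.sq_sqrt (show (0 : ℝ) ≤ (A : ℝ) ^ 2 - 4 by nlinarith)
    have := pow_le_card_mul_of_sum_balLike_eq_zero (X := X) (n := m₆)
      (c := ![A₁, A₂, A₃, A₄, A₅, A₆])
      (k := ![m₁ - m₆, m₂ - m₆, m₃ - m₆, m₄ - m₆, m₅ - m₆, 0])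
      (add_sub_cancel γ (A : ℝ)) hmul (hψ1.trans_le hψγ)
      (by simp [Fin.forall_fin_succ, *])
      (by
        simp only [Fin.sum_univ_six]
        simpa [Nat.add_sub_cancel' (show m₆ ≤ m₁ by lia),
          Nat.add_sub_cancel' (show m₆ ≤ m₂ by lia), Nat.add_sub_cancel' (show m₆ ≤ m₃ by lia),
          Nat.add_sub_cancel' (show m₆ ≤ m₄ by lia), Nat.add_sub_cancel' h56] using heq)
      (by simpa [Fin.sum_univ_six] using hne)
    simpa using this
  refine ⟨hbound, ?_⟩
  rw [le_div_iff₀ (Real.log_pos hψ1), ← Real.log_pow]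
  exact Real.log_le_log (by positivity) ((pow_le_pow_left₀ (by linarith) hψγ _).trans hbound)
end

section
/- Let A ≥ 3 be an integer, γ = (A + √(A²−4))/2, and let A₁, …, A₆ be integers with A₁ ≠ 0 and |A_i| ≤ X for all i, X ≥ 1. Suppose A₁ x_{m₁} + A₂ x_{m₂} + A₃ x_{m₃} + A₄ x_{m₄} + A₅ x_{m₅} + A₆ x_{m₆} = 0 with m₁ > m₂ > m₃ ≥ m₄ ≥ m₅ ≥ m₆ ≥ 0. Then either γ^{m₂} < 3X, or γ^{m₂ − m₃} ≤ 64X² (so m₂ − m₃ ≤ 2·log(8X)/log ψ, where ψ = (3 + √5)/2). -/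
theorem balLike_mul_sub {A : ℤ} {γ β : ℝ} (hs : γ + β = A) (hp : γ * β = 1) (n : ℕ) :
    (balLike A n : ℝ) * (γ - β) = γ ^ n - β ^ n := by
  induction n using Nat.twoStepInduction with
  | zero => simp [balLike]
  | one => simp [balLike]
  | more n ih₀ ih₁ =>
    simp only [balLike, Int.cast_sub, Int.cast_mul, ← hs]
    linear_combination (γ + β) * ih₁ - ih₀ + (γ ^ n - β ^ n) * hp

theorem pow_add_pow_eq_balLike {A : ℤ} {γ β : ℝ} (hs : γ + β = A) (hp : γ * β = 1) (n : ℕ) :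
    γ ^ n + β ^ n = ((2 * balLike A (n + 1) - A * balLike A n : ℤ) : ℝ) := by
  induction n using Nat.twoStepInduction with
  | zero => norm_num [balLike]
  | one => push_cast [balLike]; linear_combination hs
  | more n ih₀ ih₁ =>
    have h : (2 * balLike A (n + 2 + 1) - A * balLike A (n + 2) : ℤ) =
        A * (2 * balLike A (n + 1 + 1) - A * balLike A (n + 1)) -
          (2 * balLike A (n + 1) - A * balLike A n) := by
      simp only [balLike]; ring
    rw [h, Int.cast_sub, Int.cast_mul, ← ih₀, ← ih₁, ← hs]
    linear_combination (-γ ^ n - β ^ n) * hp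

theorem sq_add_sq_add_mul_mul_ne_zero {a b L : ℤ} (ha : a ≠ 0) (hL : 2 < L) :
    a ^ 2 + b ^ 2 + a * b * L ≠ 0 := by
  intro h
  have hd : (2 * b + a * L) ^ 2 = a ^ 2 * (L ^ 2 - 4) := by linear_combination 4 * h
  obtain ⟨c, hc⟩ : a ∣ 2 * b + a * L := (Int.pow_dvd_pow_iff two_ne_zero).1 ⟨_, hd⟩
  have hsq : c ^ 2 = L ^ 2 - 4 := by
    apply mul_left_cancel₀ (pow_ne_zero 2 ha)
    rw [← hd, hc]; ring
  have hc₁ : |c| < |L| := sq_lt_sq.1 (by omega)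
  have hc₂ : |L - 1| < |c| := sq_lt_sq.1 (by nlinarith)
  rw [abs_of_pos (by omega : 0 < L)] at hc₁
  rw [abs_of_pos (by omega : 0 < L - 1)] at hc₂
  omega

/-- The norm of `a γ ^ d + b` is a nonzero integer, so its two conjugates have product at least
one in absolute value. -/
theorem one_le_abs_mul_abs_conj {A : ℤ} {γ β : ℝ} (hs : γ + β = A) (hp : γ * β = 1)
    (hγ : 1 < γ) {a b : ℤ} (ha : a ≠ 0) {d : ℕ} (hd : d ≠ 0) :
    1 ≤ |a * γ ^ d + b| * |a * β ^ d + b| := by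
  have hpd : γ ^ d * β ^ d = 1 := by rw [← mul_pow, hp, one_pow]
  have hγd : 1 < γ ^ d := one_lt_pow₀ hγ hd
  set L : ℤ := 2 * balLike A (d + 1) - A * balLike A d
  have hL : γ ^ d + β ^ d = L := pow_add_pow_eq_balLike hs hp d
  have hL₂ : 2 < L := by
    have : (2 : ℝ) < L := by
      rw [← hL]; nlinarith [mul_pos (sub_pos.2 hγd) (sub_pos.2 hγd)]
    exact_mod_cast this
  have hN : (a * γ ^ d + b) * (a * β ^ d + b) = ((a ^ 2 + b ^ 2 + a * b * L : ℤ) : ℝ) := by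
    push_cast
    linear_combination (a : ℝ) ^ 2 * hpd + a * b * hL
  rw [← abs_mul, hN, ← Int.cast_abs]
  exact_mod_cast Int.one_le_abs (sq_add_sq_add_mul_mul_ne_zero ha hL₂)

theorem abs_mul_le_of_abs_le {a x X B : ℝ} (ha : |a| ≤ X) (hx : |x| ≤ B) : |a * x| ≤ X * B := by
  rw [abs_mul]
  exact mul_le_mul ha hx (abs_nonneg _) ((abs_nonneg _).trans ha)

theorem pow_sub_le_of_linear_relation {A : ℤ} {γ β X : ℝ} (hs : γ + β = A) (hp : γ * β = 1)
    (hγ : 1 < γ) {A₁ A₂ A₃ A₄ A₅ A₆ : ℤ} (hA₁ : A₁ ≠ 0)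
    (h1 : |(A₁ : ℝ)| ≤ X) (h2 : |(A₂ : ℝ)| ≤ X) (h3 : |(A₃ : ℝ)| ≤ X) (h4 : |(A₄ : ℝ)| ≤ X)
    (h5 : |(A₅ : ℝ)| ≤ X) (h6 : |(A₆ : ℝ)| ≤ X)
    {m₁ m₂ m₃ m₄ m₅ m₆ : ℕ} (h12 : m₂ < m₁) (h23 : m₃ < m₂) (h34 : m₄ ≤ m₃)
    (h45 : m₅ ≤ m₄) (h56 : m₆ ≤ m₅)
    (heq : A₁ * balLike A m₁ + A₂ * balLike A m₂ + A₃ * balLike A m₃ +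
      A₄ * balLike A m₄ + A₅ * balLike A m₅ + A₆ * balLike A m₆ = 0) :
    γ ^ (m₂ - m₃) ≤ 20 * X ^ 2 := by
  have hβ₀ : 0 < β := pos_of_mul_pos_right (hp ▸ one_pos) (by linarith)
  have hβ₁ : β ≤ 1 := by nlinarith
  have hX : 0 ≤ X := (abs_nonneg _).trans h1
  have hβ (n : ℕ) : |β ^ n| ≤ 1 := by
    rw [abs_of_pos (pow_pos hβ₀ n)]; exact pow_le_one₀ hβ₀.le hβ₁
  have hu (n : ℕ) (hn : n ≤ m₃) : |β ^ n - γ ^ n| ≤ γ ^ m₃ := by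
    have := pow_le_pow_right₀ hγ.le hn
    have := one_le_pow₀ hγ.le (n := n)
    have := hβ n
    have := pow_pos hβ₀ n
    rw [abs_le] at *
    constructor <;> linarith
  have hγ₃ : 1 ≤ γ ^ m₃ := one_le_pow₀ hγ.le
  obtain ⟨d, rfl⟩ := Nat.exists_eq_add_of_lt h12
  obtain ⟨e, rfl⟩ := Nat.exists_eq_add_of_lt h23
  have hrel : (A₁ * γ ^ (d + 1) + A₂) * γ ^ (m₃ + e + 1) =
      A₁ * β ^ (m₃ + e + 1 + d + 1) + A₂ * β ^ (m₃ + e + 1) + A₃ * (β ^ m₃ - γ ^ m₃) +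
      A₄ * (β ^ m₄ - γ ^ m₄) + A₅ * (β ^ m₅ - γ ^ m₅) + A₆ * (β ^ m₆ - γ ^ m₆) := by
    have h : (A₁ * balLike A (m₃ + e + 1 + d + 1) + A₂ * balLike A (m₃ + e + 1) +
      A₃ * balLike A m₃ + A₄ * balLike A m₄ + A₅ * balLike A m₅ + A₆ * balLike A m₆ : ℝ) = 0 :=
      mod_cast heq
    have hb := balLike_mul_sub hs hp
    linear_combination (γ - β) * h - A₁ * hb (m₃ + e + 1 + d + 1) - A₂ * hb (m₃ + e + 1) -
      A₃ * hb m₃ - A₄ * hb m₄ - A₅ * hb m₅ - A₆ * hb m₆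
  have hupper : |A₁ * γ ^ (d + 1) + A₂| * γ ^ (m₃ + e + 1) ≤ 10 * X * γ ^ m₃ := by
    rw [← abs_of_pos (pow_pos (one_pos.trans hγ) (m₃ + e + 1)), ← abs_mul, hrel]
    have b1 := abs_mul_le_of_abs_le h1 (hβ (m₃ + e + 1 + d + 1))
    have b2 := abs_mul_le_of_abs_le h2 (hβ (m₃ + e + 1))
    have b3 := abs_mul_le_of_abs_le h3 (hu m₃ le_rfl)
    have b4 := abs_mul_le_of_abs_le h4 (hu m₄ h34)
    have b5 := abs_mul_le_of_abs_le h5 (hu m₅ (h45.trans h34))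
    have b6 := abs_mul_le_of_abs_le h6 (hu m₆ (h56.trans (h45.trans h34)))
    have := mul_le_mul_of_nonneg_left hγ₃ hX
    rw [abs_le] at *
    constructor <;> linarith
  have hconj : |A₁ * β ^ (d + 1) + A₂| ≤ 2 * X := by
    have := abs_mul_le_of_abs_le h1 (hβ (d + 1))
    linarith [abs_add_le (A₁ * β ^ (d + 1)) (A₂ : ℝ)]
  have hnorm := one_le_abs_mul_abs_conj (b := A₂) hs hp hγ hA₁ d.succ_ne_zero
  have hη : |A₁ * γ ^ (d + 1) + A₂| * γ ^ (e + 1) ≤ 10 * X := by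
    refine le_of_mul_le_mul_right ?_ (one_pos.trans_le hγ₃)
    calc _ = |A₁ * γ ^ (d + 1) + A₂| * γ ^ (m₃ + e + 1) := by ring
      _ ≤ _ := hupper
  rw [show m₃ + e + 1 - m₃ = e + 1 by omega]
  have hγe : 0 < γ ^ (e + 1) := pow_pos (one_pos.trans hγ) _
  calc γ ^ (e + 1)
      ≤ |A₁ * γ ^ (d + 1) + A₂| * |A₁ * β ^ (d + 1) + A₂| * γ ^ (e + 1) :=
        le_mul_of_one_le_left hγe.le hnorm
    _ = |A₁ * γ ^ (d + 1) + A₂| * γ ^ (e + 1) * |A₁ * β ^ (d + 1) + A₂| := by ring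
    _ ≤ 10 * X * (2 * X) := by gcongr
    _ = 20 * X ^ 2 := by ring


theorem bound_m2_m3 (A : ℤ) (hA : 3 ≤ A) (γ ψ : ℝ)
    (hγ : γ = ((A : ℝ) + Real.sqrt ((A : ℝ) ^ 2 - 4)) / 2)
    (hψ : ψ = (3 + Real.sqrt 5) / 2)
    (A₁ A₂ A₃ A₄ A₅ A₆ X : ℤ) (hA₁ : A₁ ≠ 0) (hX : 1 ≤ X)
    (h1 : |A₁| ≤ X) (h2 : |A₂| ≤ X) (h3 : |A₃| ≤ X) (h4 : |A₄| ≤ X)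
    (h5 : |A₅| ≤ X) (h6 : |A₆| ≤ X)
    (m₁ m₂ m₃ m₄ m₅ m₆ : ℕ) (h12 : m₁ > m₂) (h23 : m₂ > m₃) (h34 : m₃ ≥ m₄)
    (h45 : m₄ ≥ m₅) (h56 : m₅ ≥ m₆)
    (heq : A₁ * balLike A m₁ + A₂ * balLike A m₂ + A₃ * balLike A m₃ +
      A₄ * balLike A m₄ + A₅ * balLike A m₅ + A₆ * balLike A m₆ = 0) :
    γ ^ m₂ < 3 * (X : ℝ) ∨
    (γ ^ (m₂ - m₃) ≤ 64 * (X : ℝ) ^ 2 ∧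
      ((m₂ - m₃ : ℕ) : ℝ) ≤ 2 * Real.log (8 * (X : ℝ)) / Real.log ψ) := by
  right
  have hA' : (3 : ℝ) ≤ A := mod_cast hA
  have hX' : (1 : ℝ) ≤ X := mod_cast hX
  have hψ₁ : 1 < ψ := by linarith [Real.sqrt_nonneg 5]
  have hψγ : ψ ≤ γ := by
    have : Real.sqrt 5 ≤ Real.sqrt ((A : ℝ) ^ 2 - 4) := Real.sqrt_le_sqrt (by nlinarith)
    linarith
  have hp : γ * (A - γ) = 1 := by
    have := Real.sq_sqrt (show (0 : ℝ) ≤ (A : ℝ) ^ 2 - 4 by nlinarith)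
    rw [hγ]; linear_combination -this / 4
  have hpow : γ ^ (m₂ - m₃) ≤ 64 * (X : ℝ) ^ 2 :=
    (pow_sub_le_of_linear_relation (X := X) (add_sub_cancel γ (A : ℝ)) hp (hψ₁.trans_le hψγ) hA₁
      (mod_cast h1) (mod_cast h2) (mod_cast h3) (mod_cast h4) (mod_cast h5) (mod_cast h6)
      h12 h23 h34 h45 h56 heq).trans (by nlinarith)
  refine ⟨hpow, ?_⟩
  rw [le_div_iff₀ (Real.log_pos hψ₁), ← Real.log_pow]
  have hlog := Real.log_pow (8 * (X : ℝ)) 2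
  push_cast at hlog
  rw [← hlog]
  refine Real.log_le_log (by positivity) ?_
  calc ψ ^ (m₂ - m₃) ≤ γ ^ (m₂ - m₃) := by gcongr
    _ ≤ 64 * (X : ℝ) ^ 2 := hpow
    _ = (8 * (X : ℝ)) ^ 2 := by ring
end
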